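/- For any Lie superalgebras L and M over a field F (char F ≠ 2,3), with L, M and L ⊕ M acting on themselves and on each other by Lie brackets (L and M acting trivially on each other), there is an isomorphism of Lie superalgebras (L ⊕ M) ⊗ (L ⊕ M) ≅ (L ⊗ L) ⊕ (L ⊗ M) ⊕ (M ⊗ L) ⊕ (M ⊗ M). -/

import Mathlib

/-!
Common definitions: Lie superalgebras over a field `F` (char ≠ 2,3 where needed),
graded ideals, centers, capability, epicenter, non-abelian tensor and exterior
products (characterized by generators-and-relations universal properties),
free Lie superalgebras, Schur multipliers, Heisenberg Lie superalgebras, etc.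
-/

namespace SuperLie

open Submodule Function Module

universe u v w

/-- The sign `(-1)^{|a||b|}` attached to a pair of `ℤ₂`-degrees. -/
def sg (F : Type u) [Field F] (a b : ZMod 2) : F := (-1 : F) ^ (a.val * b.val)

/-- A Lie superalgebra over `F`: a `ℤ₂`-graded vector space `L = L₀ ⊕ L₁`
together with an even bilinear bracket satisfying graded skew-symmetry and the
graded Jacobi identity (on homogeneous elements). -/
class LieSuper (F : Type u) [Field F] (L : Type v) [AddCommGroup L] [Module F L] where
  gr : ZMod 2 → Submodule F L
  isCompl_gr : IsCompl (gr 0) (gr 1)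
  br : L → L → L
  br_add_left : ∀ x y z : L, br (x + y) z = br x z + br y z
  br_add_right : ∀ x y z : L, br x (y + z) = br x y + br x z
  br_smul_left : ∀ (c : F) (x y : L), br (c • x) y = c • br x y
  br_smul_right : ∀ (c : F) (x y : L), br x (c • y) = c • br x y
  br_gr : ∀ a b : ZMod 2, ∀ x ∈ gr a, ∀ y ∈ gr b, br x y ∈ gr (a + b)
  br_skew : ∀ a b : ZMod 2, ∀ x ∈ gr a, ∀ y ∈ gr b, br x y = -(sg F a b) • br y x
  br_jacobi : ∀ a b c : ZMod 2, ∀ x ∈ gr a, ∀ y ∈ gr b, ∀ z ∈ gr c,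
    sg F a c • br x (br y z) + sg F b a • br y (br z x) + sg F c b • br z (br x y) = 0

/-- The `a`-graded piece of a Lie superalgebra. -/
def grd (F : Type u) [Field F] (L : Type v) [AddCommGroup L] [Module F L] [LieSuper F L]
    (a : ZMod 2) : Submodule F L :=
  LieSuper.gr a

/-- The bracket of a Lie superalgebra. -/
def sbr (F : Type u) [Field F] {L : Type v} [AddCommGroup L] [Module F L] [LieSuper F L]
    (x y : L) : L :=
  LieSuper.br (F := F) x y

/-- The center `Z(L) = {z ∈ L : [z,x] = 0 for all x ∈ L}`. -/
def centerS (F : Type u) [Field F] (L : Type v) [AddCommGroup L] [Module F L] [LieSuper F L] :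
    Submodule F L where
  carrier := {z : L | ∀ x : L, sbr F z x = 0}
  add_mem' := by
    intro a b ha hb x
    simp only [Set.mem_setOf_eq, sbr] at ha hb ⊢
    rw [LieSuper.br_add_left, ha x, hb x, add_zero]
  zero_mem' := by
    intro x
    have h := LieSuper.br_smul_left (F := F) (0 : F) (0 : L) x
    simp only [Set.mem_setOf_eq, sbr, zero_smul] at h ⊢
    simpa using h
  smul_mem' := by
    intro c a ha x
    simp only [Set.mem_setOf_eq, sbr] at ha ⊢
    rw [LieSuper.br_smul_left, ha x, smul_zero]

/-- Homomorphisms of Lie superalgebras: even (grading preserving) linear maps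
which preserve the bracket. -/
def IsHom (F : Type u) [Field F] {L : Type v} {M : Type w}
    [AddCommGroup L] [Module F L] [LieSuper F L]
    [AddCommGroup M] [Module F M] [LieSuper F M] (f : L →ₗ[F] M) : Prop :=
  (∀ a : ZMod 2, ∀ x ∈ grd F L a, f x ∈ grd F M a) ∧
  (∀ x y : L, f (sbr F x y) = sbr F (f x) (f y))

/-- A bundled Lie superalgebra over `F`. -/
structure LieSupAlg (F : Type u) [Field F] : Type (max u (v + 1)) where
  carrier : Type v
  [iag : AddCommGroup carrier]
  [imo : Module F carrier]
  [ils : LieSuper F carrier]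

attribute [instance] LieSupAlg.iag LieSupAlg.imo LieSupAlg.ils

instance (F : Type u) [Field F] : CoeSort (LieSupAlg.{u, v} F) (Type v) :=
  ⟨LieSupAlg.carrier⟩

/-- A Lie superalgebra `L` is capable if `L ≅ H/Z(H)` for some Lie superalgebra `H`,
i.e. there is a surjective homomorphism onto `L` whose kernel is exactly the center. -/
def Capable (F : Type u) [Field F] (L : Type v) [AddCommGroup L] [Module F L]
    [LieSuper F L] : Prop :=
  ∃ (H : LieSupAlg.{u, max u v} F) (φ : H.carrier →ₗ[F] L),
    IsHom F φ ∧ Surjective φ ∧ LinearMap.ker φ = centerS F H.carrier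

/-- Graded ideals of a Lie superalgebra. -/
def IsGIdeal (F : Type u) [Field F] {L : Type v} [AddCommGroup L] [Module F L]
    [LieSuper F L] (I : Submodule F L) : Prop :=
  (∀ x ∈ I, ∀ y : L, sbr F x y ∈ I) ∧ (∀ y : L, ∀ x ∈ I, sbr F y x ∈ I) ∧
  (∀ x ∈ I, ∃ x0 ∈ I ⊓ grd F L 0, ∃ x1 ∈ I ⊓ grd F L 1, x = x0 + x1)

/-- The graded ideal generated by a subset. -/
def idealClosure (F : Type u) [Field F] {L : Type v} [AddCommGroup L] [Module F L]
    [LieSuper F L] (S : Set L) : Submodule F L :=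
  sInf {I : Submodule F L | IsGIdeal F I ∧ S ⊆ ↑I}

/-- `QuotCapable F L N` expresses that the quotient Lie superalgebra `L/N` is capable. -/
def QuotCapable (F : Type u) [Field F] (L : Type v) [AddCommGroup L] [Module F L]
    [LieSuper F L] (N : Submodule F L) : Prop :=
  ∃ (Q : LieSupAlg.{u, max u v} F) (π : L →ₗ[F] Q.carrier),
    IsHom F π ∧ Surjective π ∧ LinearMap.ker π = N ∧ Capable F Q.carrier

/-- The epicenter `Z^*(L)`: the smallest graded ideal of `L` such that the
corresponding quotient is capable. -/
def IsEpicenter (F : Type u) [Field F] (L : Type v) [AddCommGroup L] [Module F L]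
    [LieSuper F L] (Z : Submodule F L) : Prop :=
  IsGIdeal F Z ∧ QuotCapable F L Z ∧
  ∀ N : Submodule F L, IsGIdeal F N → QuotCapable F L N → Z ≤ N

/-- The submodule `[I,J]` spanned by brackets. -/
def bracketSpan (F : Type u) [Field F] {L : Type v} [AddCommGroup L] [Module F L]
    [LieSuper F L] (I J : Submodule F L) : Submodule F L :=
  Submodule.span F {z : L | ∃ x ∈ I, ∃ y ∈ J, z = sbr F x y}

/-- The derived subalgebra `L' = [L,L]`. -/
def derived (F : Type u) [Field F] (L : Type v) [AddCommGroup L] [Module F L]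
    [LieSuper F L] : Submodule F L :=
  bracketSpan F (⊤ : Submodule F L) ⊤

/-- The lower central series of a Lie superalgebra. -/
def lowerCentral (F : Type u) [Field F] (L : Type v) [AddCommGroup L] [Module F L]
    [LieSuper F L] : ℕ → Submodule F L
  | 0 => ⊤
  | n + 1 => bracketSpan F (lowerCentral F L n) ⊤

/-- A Lie superalgebra is nilpotent if its lower central series terminates at zero. -/
def IsNilp (F : Type u) [Field F] (L : Type v) [AddCommGroup L] [Module F L]
    [LieSuper F L] : Prop :=
  ∃ n : ℕ, lowerCentral F L n = ⊥

/-- An action of a Lie superalgebra `P` on a Lie superalgebra `M`: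
an even bilinear map satisfying the two action axioms. -/
structure IsAction (F : Type u) [Field F] {P : Type v} {M : Type v}
    [AddCommGroup P] [Module F P] [LieSuper F P]
    [AddCommGroup M] [Module F M] [LieSuper F M] (act : P → M → M) : Prop where
  add_left : ∀ (p q : P) (m : M), act (p + q) m = act p m + act q m
  add_right : ∀ (p : P) (m m' : M), act p (m + m') = act p m + act p m'
  smul_left : ∀ (c : F) (p : P) (m : M), act (c • p) m = c • act p m
  smul_right : ∀ (c : F) (p : P) (m : M), act p (c • m) = c • act p m
  grade : ∀ a b : ZMod 2, ∀ p ∈ grd F P a, ∀ m ∈ grd F M b, act p m ∈ grd F M (a + b)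
  br_act : ∀ a b : ZMod 2, ∀ p ∈ grd F P a, ∀ p' ∈ grd F P b, ∀ m : M,
    act (sbr F p p') m = act p (act p' m) - sg F a b • act p' (act p m)
  act_br : ∀ a b : ZMod 2, ∀ p ∈ grd F P a, ∀ m ∈ grd F M b, ∀ m' : M,
    act p (sbr F m m') = sbr F (act p m) m' + sg F a b • sbr F m (act p m')

/-- Compatibility of mutual actions of two Lie superalgebras on each other. -/
def Compatible (F : Type u) [Field F] {M : Type v} {N : Type v}
    [AddCommGroup M] [Module F M] [LieSuper F M]
    [AddCommGroup N] [Module F N] [LieSuper F N]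
    (actMN : M → N → N) (actNM : N → M → M) : Prop :=
  (∀ a b : ZMod 2, ∀ m ∈ grd F M a, ∀ n ∈ grd F N b, ∀ n' : N,
      actMN (actNM n m) n' = -(sg F a b) • sbr F (actMN m n) n') ∧
  (∀ a b : ZMod 2, ∀ m ∈ grd F M a, ∀ n ∈ grd F N b, ∀ m' : M,
      actNM (actMN m n) m' = -(sg F a b) • sbr F (actNM n m) m')

/-- The defining relations of the non-abelian tensor product `M ⊗ N` of Lie
superalgebras (with given mutual actions), satisfied by a pairing `q` into `T`. -/
structure TensorRel (F : Type u) [Field F] {M : Type v} {N : Type v} {T : Type w}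
    [AddCommGroup M] [Module F M] [LieSuper F M]
    [AddCommGroup N] [Module F N] [LieSuper F N]
    [AddCommGroup T] [Module F T] [LieSuper F T]
    (actMN : M → N → N) (actNM : N → M → M) (q : M → N → T) : Prop where
  add_left : ∀ (m m' : M) (n : N), q (m + m') n = q m n + q m' n
  add_right : ∀ (m : M) (n n' : N), q m (n + n') = q m n + q m n'
  smul_left : ∀ (c : F) (m : M) (n : N), q (c • m) n = c • q m n
  smul_right : ∀ (c : F) (m : M) (n : N), q m (c • n) = c • q m n
  grade : ∀ a b : ZMod 2, ∀ m ∈ grd F M a, ∀ n ∈ grd F N b, q m n ∈ grd F T (a + b)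
  brk_left : ∀ a b : ZMod 2, ∀ m ∈ grd F M a, ∀ m' ∈ grd F M b, ∀ n : N,
    q (sbr F m m') n = q m (actMN m' n) - sg F a b • q m' (actMN m n)
  brk_right : ∀ a b c : ZMod 2, ∀ m ∈ grd F M a, ∀ n ∈ grd F N b, ∀ n' ∈ grd F N c,
    q m (sbr F n n') = sg F c (a + b) • q (actNM n' m) n - sg F a b • q (actNM n m) n'
  brk_brk : ∀ a b : ZMod 2, ∀ m ∈ grd F M a, ∀ n ∈ grd F N b, ∀ (m' : M) (n' : N),
    sbr F (q m n) (q m' n') = -(sg F a b) • q (actNM n m) (actMN m' n')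

/-- `IsTensorObj F actMN actNM t` says that `(T, t)` is the non-abelian tensor
product `M ⊗ N`: the pairing `t` satisfies the defining relations and is
universal among all pairings satisfying them. -/
structure IsTensorObj (F : Type u) [Field F] {M : Type v} {N : Type v} {T : Type v}
    [AddCommGroup M] [Module F M] [LieSuper F M]
    [AddCommGroup N] [Module F N] [LieSuper F N]
    [AddCommGroup T] [Module F T] [LieSuper F T]
    (actMN : M → N → N) (actNM : N → M → M) (t : M → N → T) : Prop where
  rel : TensorRel F actMN actNM t
  lift : ∀ (Q : LieSupAlg.{u, max u v} F) (q : M → N → Q.carrier),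
    TensorRel F actMN actNM q →
    ∃! h : T →ₗ[F] Q.carrier, IsHom F h ∧ ∀ (m : M) (n : N), h (t m n) = q m n

/-- The defining relations of the non-abelian exterior square `L ∧ L` of a Lie
superalgebra (the tensor relations for the bracket actions, together with the
graded alternating relations coming from `L □ L`). -/
structure ExtRel (F : Type u) [Field F] {L : Type v} {T : Type w}
    [AddCommGroup L] [Module F L] [LieSuper F L]
    [AddCommGroup T] [Module F T] [LieSuper F T] (q : L → L → T) : Prop where
  toTensor : TensorRel F (fun x y : L => sbr F x y) (fun x y : L => sbr F x y) q
  alt : ∀ a b : ZMod 2, ∀ x ∈ grd F L a, ∀ y ∈ grd F L b, q x y = -(sg F a b) • q y x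
  alt_even : ∀ x ∈ grd F L 0, q x x = 0

/-- `IsExtObj F t` says that `(E, t)` is the non-abelian exterior square `L ∧ L`. -/
structure IsExtObj (F : Type u) [Field F] {L : Type v} {E : Type v}
    [AddCommGroup L] [Module F L] [LieSuper F L]
    [AddCommGroup E] [Module F E] [LieSuper F E] (t : L → L → E) : Prop where
  rel : ExtRel F t
  lift : ∀ (Q : LieSupAlg.{u, max u v} F) (q : L → L → Q.carrier),
    ExtRel F q →
    ∃! h : E →ₗ[F] Q.carrier, IsHom F h ∧ ∀ x y : L, h (t x y) = q x y

/-- A free Lie superalgebra: free on some `ℤ₂`-graded subset `X`. -/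
def IsFreeLieSuper (F : Type u) [Field F] (Fr : Type v) [AddCommGroup Fr] [Module F Fr]
    [LieSuper F Fr] : Prop :=
  ∃ X : ZMod 2 → Set Fr,
    (∀ a : ZMod 2, X a ⊆ (grd F Fr a : Set Fr)) ∧
    ∀ (Q : LieSupAlg.{u, max u v} F) (f : ∀ a : ZMod 2, X a → Q.carrier),
      (∀ (a : ZMod 2) (x : X a), f a x ∈ grd F Q.carrier a) →
      ∃! h : Fr →ₗ[F] Q.carrier,
        IsHom F h ∧ ∀ (a : ZMod 2) (x : X a), h (x : Fr) = f a x

/-- `F' ∩ R`, for a free presentation with kernel `R`. -/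
abbrev schurA (F : Type u) [Field F] (Fr : Type v) [AddCommGroup Fr] [Module F Fr]
    [LieSuper F Fr] (R : Submodule F Fr) : Submodule F Fr :=
  derived F Fr ⊓ R

/-- The Schur multiplier `M(L) = (F' ∩ R)/[R,F]` attached to a free presentation
`0 → R → F → L → 0`. -/
abbrev SchurMul (F : Type u) [Field F] (Fr : Type v) [AddCommGroup Fr] [Module F Fr]
    [LieSuper F Fr] (R : Submodule F Fr) :=
  ↥(schurA F Fr R) ⧸ (Submodule.comap (schurA F Fr R).subtype (bracketSpan F R ⊤))

/-- `L` is (isomorphic to) the special Heisenberg Lie superalgebra `H(m,n)` with even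
center: basis `x₁,…,x_{2m}, z` (even), `y₁,…,y_n` (odd), with `[xᵢ, x_{m+i}] = z`,
`[y_j, y_j] = z` and `z` central. -/
def IsHeisE (F : Type u) [Field F] (m n : ℕ) (L : Type v) [AddCommGroup L] [Module F L]
    [LieSuper F L] : Prop :=
  ∃ (x : Fin (2 * m) → L) (y : Fin n → L) (z : L),
    (∀ i, x i ∈ grd F L 0) ∧ z ∈ grd F L 0 ∧ (∀ j, y j ∈ grd F L 1) ∧
    LinearIndependent F (Sum.elim x (Sum.elim y (fun _ : Unit => z))) ∧
    Submodule.span F (Set.range (Sum.elim x (Sum.elim y (fun _ : Unit => z)))) = ⊤ ∧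
    (∀ i j : Fin (2 * m), sbr F (x i) (x j) =
      if (j : ℕ) = (i : ℕ) + m then z else if (i : ℕ) = (j : ℕ) + m then -z else 0) ∧
    (∀ (i : Fin (2 * m)) (j : Fin n), sbr F (x i) (y j) = 0) ∧
    (∀ (i : Fin (2 * m)) (j : Fin n), sbr F (y j) (x i) = 0) ∧
    (∀ i j : Fin n, sbr F (y i) (y j) = if i = j then z else 0) ∧
    (∀ w : L, sbr F z w = 0) ∧ (∀ w : L, sbr F w z = 0)

/-- `L` is (isomorphic to) the Heisenberg Lie superalgebra `H_m` with odd center: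
basis `x₁,…,x_m` (even), `y₁,…,y_m, z` (odd), with `[x_j, y_j] = z` and `z` central. -/
def IsHeisO (F : Type u) [Field F] (m : ℕ) (L : Type v) [AddCommGroup L] [Module F L]
    [LieSuper F L] : Prop :=
  ∃ (x : Fin m → L) (y : Fin m → L) (z : L),
    (∀ i, x i ∈ grd F L 0) ∧ (∀ j, y j ∈ grd F L 1) ∧ z ∈ grd F L 1 ∧
    LinearIndependent F (Sum.elim x (Sum.elim y (fun _ : Unit => z))) ∧
    Submodule.span F (Set.range (Sum.elim x (Sum.elim y (fun _ : Unit => z)))) = ⊤ ∧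
    (∀ i j : Fin m, sbr F (x i) (x j) = 0) ∧
    (∀ i j : Fin m, sbr F (x i) (y j) = if i = j then z else 0) ∧
    (∀ i j : Fin m, sbr F (y j) (x i) = if i = j then -z else 0) ∧
    (∀ i j : Fin m, sbr F (y i) (y j) = 0) ∧
    (∀ w : L, sbr F z w = 0) ∧ (∀ w : L, sbr F w z = 0)

/-- `A` is (isomorphic to) the abelian Lie superalgebra `A(r | s)` of
superdimension `(r | s)`. -/
def IsAbelSuper (F : Type u) [Field F] (r s : ℕ) (A : Type v) [AddCommGroup A]
    [Module F A] [LieSuper F A] : Prop :=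
  (∀ x y : A, sbr F x y = 0) ∧ Module.Finite F A ∧
  Module.finrank F ↥(grd F A 0) = r ∧ Module.finrank F ↥(grd F A 1) = s

/-- The direct sum (product) of two Lie superalgebras. -/
instance prodLieSuper (F : Type u) [Field F] (A : Type v) (B : Type w)
    [AddCommGroup A] [Module F A] [LieSuper F A]
    [AddCommGroup B] [Module F B] [LieSuper F B] : LieSuper F (A × B) where
  gr a := (grd F A a).prod (grd F B a)
  isCompl_gr := by
    have hA : IsCompl (grd F A 0) (grd F A 1) := LieSuper.isCompl_gr
    have hB : IsCompl (grd F B 0) (grd F B 1) := LieSuper.isCompl_gr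
    constructor
    · rw [disjoint_iff, eq_bot_iff]
      rintro ⟨a, b⟩ h
      rw [Submodule.mem_inf] at h
      obtain ⟨h0, h1⟩ := h
      rw [Submodule.mem_prod] at h0 h1
      have ha : a = 0 := by
        have := hA.disjoint.le_bot (Submodule.mem_inf.mpr ⟨h0.1, h1.1⟩)
        simpa using this
      have hb : b = 0 := by
        have := hB.disjoint.le_bot (Submodule.mem_inf.mpr ⟨h0.2, h1.2⟩)
        simpa using this
      simp [ha, hb, Prod.ext_iff]
    · rw [codisjoint_iff, eq_top_iff]
      rintro ⟨a, b⟩ -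
      have ha' : a ∈ grd F A 0 ⊔ grd F A 1 := by
        rw [hA.codisjoint.eq_top]; trivial
      have hb' : b ∈ grd F B 0 ⊔ grd F B 1 := by
        rw [hB.codisjoint.eq_top]; trivial
      obtain ⟨a0, ha0, a1, ha1, rfl⟩ := Submodule.mem_sup.mp ha'
      obtain ⟨b0, hb0, b1, hb1, rfl⟩ := Submodule.mem_sup.mp hb'
      refine Submodule.mem_sup.mpr ⟨(a0, b0), ?_, (a1, b1), ?_, ?_⟩
      · exact Submodule.mem_prod.mpr ⟨ha0, hb0⟩
      · exact Submodule.mem_prod.mpr ⟨ha1, hb1⟩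
      · rfl
  br x y := (sbr F x.1 y.1, sbr F x.2 y.2)
  br_add_left := by
    intro x y z
    simp only [Prod.fst_add, Prod.snd_add, sbr, LieSuper.br_add_left]
    rfl
  br_add_right := by
    intro x y z
    simp only [Prod.fst_add, Prod.snd_add, sbr, LieSuper.br_add_right]
    rfl
  br_smul_left := by
    intro c x y
    simp only [Prod.smul_fst, Prod.smul_snd, sbr, LieSuper.br_smul_left]
    rfl
  br_smul_right := by
    intro c x y
    simp only [Prod.smul_fst, Prod.smul_snd, sbr, LieSuper.br_smul_right]
    rfl
  br_gr := by
    intro a b x hx y hy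
    rw [Submodule.mem_prod] at hx hy ⊢
    exact ⟨LieSuper.br_gr a b x.1 hx.1 y.1 hy.1, LieSuper.br_gr a b x.2 hx.2 y.2 hy.2⟩
  br_skew := by
    intro a b x hx y hy
    rw [Submodule.mem_prod] at hx hy
    have h1 := LieSuper.br_skew (F := F) a b x.1 hx.1 y.1 hy.1
    have h2 := LieSuper.br_skew (F := F) a b x.2 hx.2 y.2 hy.2
    simp only [sbr]
    rw [Prod.ext_iff]
    exact ⟨h1, h2⟩
  br_jacobi := by
    intro a b c x hx y hy z hz
    rw [Submodule.mem_prod] at hx hy hz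
    have h1 := LieSuper.br_jacobi (F := F) a b c x.1 hx.1 y.1 hy.1 z.1 hz.1
    have h2 := LieSuper.br_jacobi (F := F) a b c x.2 hx.2 y.2 hy.2 z.2 hz.2
    simp only [sbr]
    rw [Prod.ext_iff]
    exact ⟨h1, h2⟩

theorem exists_decomp (F : Type u) [Field F] {L : Type v} [AddCommGroup L] [Module F L]
    [LieSuper F L] (x : L) : ∃ x0 ∈ grd F L 0, ∃ x1 ∈ grd F L 1, x0 + x1 = x := by
  have hA : IsCompl (grd F L 0) (grd F L 1) := LieSuper.isCompl_gr
  have : x ∈ grd F L 0 ⊔ grd F L 1 := by rw [hA.codisjoint.eq_top]; trivial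
  exact Submodule.mem_sup.mp this

theorem sbr_zero_left (F : Type u) [Field F] {L : Type v} [AddCommGroup L] [Module F L]
    [LieSuper F L] (x : L) : sbr F 0 x = 0 := by
  have h := LieSuper.br_smul_left (F := F) (0 : F) (0 : L) x
  simpa [sbr] using h

theorem sbr_zero_right (F : Type u) [Field F] {L : Type v} [AddCommGroup L] [Module F L]
    [LieSuper F L] (x : L) : sbr F x 0 = 0 := by
  have h := LieSuper.br_smul_right (F := F) (0 : F) x (0 : L)
  simpa [sbr] using h

theorem sbr_add_left (F : Type u) [Field F] {L : Type v} [AddCommGroup L] [Module F L]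
    [LieSuper F L] (x y z : L) : sbr F (x + y) z = sbr F x z + sbr F y z :=
  LieSuper.br_add_left x y z

theorem sbr_add_right (F : Type u) [Field F] {L : Type v} [AddCommGroup L] [Module F L]
    [LieSuper F L] (x y z : L) : sbr F x (y + z) = sbr F x y + sbr F x z :=
  LieSuper.br_add_right x y z

theorem sbr_smul_left (F : Type u) [Field F] {L : Type v} [AddCommGroup L] [Module F L]
    [LieSuper F L] (c : F) (x z : L) : sbr F (c • x) z = c • sbr F x z :=
  LieSuper.br_smul_left c x z

theorem sbr_smul_right (F : Type u) [Field F] {L : Type v} [AddCommGroup L] [Module F L]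
    [LieSuper F L] (c : F) (x z : L) : sbr F x (c • z) = c • sbr F x z :=
  LieSuper.br_smul_right c x z

theorem sbr_prod (F : Type u) [Field F] {A : Type v} {B : Type w}
    [AddCommGroup A] [Module F A] [LieSuper F A]
    [AddCommGroup B] [Module F B] [LieSuper F B] (x y : A × B) :
    sbr F x y = (sbr F x.1 y.1, sbr F x.2 y.2) := rfl

theorem mem_grd_prod (F : Type u) [Field F] {A : Type v} {B : Type w}
    [AddCommGroup A] [Module F A] [LieSuper F A]
    [AddCommGroup B] [Module F B] [LieSuper F B] (a : ZMod 2) (x : A × B) :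
    x ∈ grd F (A × B) a ↔ x.1 ∈ grd F A a ∧ x.2 ∈ grd F B a := Submodule.mem_prod

/-- Pull back a Lie superalgebra structure along an injective linear map. -/
@[reducible] def pull (F : Type u) [Field F] {A : Type w} {T : Type v}
    [AddCommGroup A] [Module F A] [AddCommGroup T] [Module F T] [LieSuper F T]
    (i : A →ₗ[F] T) (hi : Injective i) (b : A → A → A)
    (hb : ∀ x y, i (b x y) = sbr F (i x) (i y))
    (hg : ∀ x, ∃ x0 x1 : A, i x0 ∈ grd F T 0 ∧ i x1 ∈ grd F T 1 ∧ x0 + x1 = x) :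
    LieSuper F A where
  gr a := (grd F T a).comap i
  isCompl_gr := by
    have hA : IsCompl (grd F T 0) (grd F T 1) := LieSuper.isCompl_gr
    constructor
    · rw [disjoint_iff, eq_bot_iff]
      intro x hx
      rw [Submodule.mem_inf] at hx
      have := hA.disjoint.le_bot (Submodule.mem_inf.mpr ⟨hx.1, hx.2⟩)
      rw [Submodule.mem_bot] at this ⊢
      exact hi (by rw [this, map_zero])
    · rw [codisjoint_iff, eq_top_iff]
      intro x _
      obtain ⟨x0, x1, h0, h1, h⟩ := hg x
      exact Submodule.mem_sup.mpr ⟨x0, h0, x1, h1, h⟩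
  br := b
  br_add_left x y z := hi (by simp only [hb, map_add, sbr_add_left])
  br_add_right x y z := hi (by simp only [hb, map_add, sbr_add_right])
  br_smul_left c x y := hi (by simp only [hb, map_smul, sbr_smul_left])
  br_smul_right c x y := hi (by simp only [hb, map_smul, sbr_smul_right])
  br_gr a c x hx y hy := by
    rw [Submodule.mem_comap, hb]
    exact LieSuper.br_gr a c _ hx _ hy
  br_skew a c x hx y hy := hi (by
    rw [map_smul, hb, hb]
    exact LieSuper.br_skew a c _ hx _ hy)
  br_jacobi a c d x hx y hy z hz := hi (by
    simp only [map_add, map_smul, hb, map_zero]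
    exact LieSuper.br_jacobi a c d _ hx _ hy _ hz)

/-- A pairing into `A` satisfies the tensor relations if it does so after an
injective graded bracket-preserving map. -/
theorem TensorRel.of_inj {F : Type u} [Field F] {M N : Type v} {A T : Type*}
    [AddCommGroup M] [Module F M] [LieSuper F M]
    [AddCommGroup N] [Module F N] [LieSuper F N]
    [AddCommGroup A] [Module F A] [LieSuper F A]
    [AddCommGroup T] [Module F T] [LieSuper F T]
    {actMN : M → N → N} {actNM : N → M → M} {q : M → N → A}
    (i : A →ₗ[F] T) (hi : Injective i)
    (hb : ∀ x y, i (sbr F x y) = sbr F (i x) (i y))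
    (hg : ∀ a x, i x ∈ grd F T a → x ∈ grd F A a)
    (h : TensorRel F actMN actNM (fun m n => i (q m n))) : TensorRel F actMN actNM q where
  add_left m m' n := hi (by simpa only [map_add] using h.add_left m m' n)
  add_right m m' n := hi (by simpa only [map_add] using h.add_right m m' n)
  smul_left m m' n := hi (by simpa only [map_smul] using h.smul_left m m' n)
  smul_right m m' n := hi (by simpa only [map_smul] using h.smul_right m m' n)
  grade a b m hm n hn := hg _ _ (h.grade a b m hm n hn)
  brk_left a b m hm m' hm' n := hi (by
    simpa only [map_sub, map_smul] using h.brk_left a b m hm m' hm' n)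
  brk_right a b c m hm m' hm' n hn := hi (by
    simpa only [map_sub, map_smul] using h.brk_right a b c m hm m' hm' n hn)
  brk_brk a b m hm n hn m' n' := hi (by
    simpa only [map_smul, hb] using h.brk_brk a b m hm n hn m' n')

theorem lift_small {F : Type u} [Field F] {M N T Q : Type v}
    [AddCommGroup M] [Module F M] [LieSuper F M]
    [AddCommGroup N] [Module F N] [LieSuper F N]
    [AddCommGroup T] [Module F T] [LieSuper F T]
    [AddCommGroup Q] [Module F Q] [LieSuper F Q]
    {actMN : M → N → N} {actNM : N → M → M} {t : M → N → T}
    (ht : IsTensorObj F actMN actNM t) (q : M → N → Q) (hq : TensorRel F actMN actNM q) :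
    ∃! h : T →ₗ[F] Q, IsHom F h ∧ ∀ (m : M) (n : N), h (t m n) = q m n := by
  let i : ULift.{u} Q →ₗ[F] Q := ULift.moduleEquiv.toLinearMap
  have hi : Injective i := ULift.moduleEquiv.injective
  letI : LieSuper F (ULift.{u} Q) := pull F i hi (fun x y => ⟨sbr F x.down y.down⟩)
    (fun x y => rfl) (fun x => by
      obtain ⟨x0, h0, x1, h1, h⟩ := exists_decomp F x.down
      exact ⟨⟨x0⟩, ⟨x1⟩, h0, h1, ULift.ext _ _ h⟩)
  have hrel : TensorRel F actMN actNM (fun m n => (ULift.up (q m n) : ULift.{u} Q)) :=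
    TensorRel.of_inj i hi (fun _ _ => rfl) (fun _ _ h => h) hq
  obtain ⟨h, ⟨⟨h1, h2⟩, h3⟩, hu⟩ := ht.lift ⟨ULift.{u} Q⟩ _ hrel
  refine ⟨i ∘ₗ h, ⟨⟨fun a x hx => h1 a x hx, fun x y => ?_⟩, fun m n => ?_⟩, ?_⟩
  · exact congrArg i (h2 x y)
  · exact congrArg i (h3 m n)
  · rintro g ⟨⟨g1, g2⟩, g3⟩
    have := hu (ULift.moduleEquiv.symm.toLinearMap ∘ₗ g) ⟨⟨fun a x hx => g1 a x hx, fun x y => ?_⟩,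
      fun m n => ?_⟩
    · rw [← this]; rfl
    · exact ULift.ext _ _ (g2 x y)
    · exact ULift.ext _ _ (g3 m n)

theorem span_eq_top {F : Type u} [Field F] {M N T : Type v}
    [AddCommGroup M] [Module F M] [LieSuper F M]
    [AddCommGroup N] [Module F N] [LieSuper F N]
    [AddCommGroup T] [Module F T] [LieSuper F T]
    {actMN : M → N → N} {actNM : N → M → M} {t : M → N → T}
    (ht : IsTensorObj F actMN actNM t) :
    Submodule.span F {x : T | ∃ m n, x = t m n} = ⊤ := by
  set S := Submodule.span F {x : T | ∃ m n, x = t m n} with hS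
  have hmem : ∀ m n, t m n ∈ S := fun m n => Submodule.subset_span ⟨m, n, rfl⟩
  have r := ht.rel
  have hgen : ∀ m n m' n', sbr F (t m n) (t m' n') ∈ S := by
    intro m n m' n'
    obtain ⟨m0, hm0, m1, hm1, rfl⟩ := exists_decomp F m
    obtain ⟨n0, hn0, n1, hn1, rfl⟩ := exists_decomp F n
    simp only [r.add_left, r.add_right, sbr_add_left]
    rw [r.brk_brk 0 0 m0 hm0 n0 hn0, r.brk_brk 0 1 m0 hm0 n1 hn1,
      r.brk_brk 1 0 m1 hm1 n0 hn0, r.brk_brk 1 1 m1 hm1 n1 hn1]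
    refine S.add_mem (S.add_mem ?_ ?_) (S.add_mem ?_ ?_) <;> exact S.smul_mem _ (hmem _ _)
  have hbr : ∀ x ∈ S, ∀ y ∈ S, sbr F x y ∈ S := by
    intro x hx y hy
    refine Submodule.span_induction (p := fun x _ => sbr F x y ∈ S) ?_ ?_ ?_ ?_ hx
    · rintro _ ⟨m, n, rfl⟩
      refine Submodule.span_induction (p := fun y _ => sbr F (t m n) y ∈ S) ?_ ?_ ?_ ?_ hy
      · rintro _ ⟨m', n', rfl⟩
        exact hgen m n m' n'
      · rw [sbr_zero_right]; exact S.zero_mem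
      · intro a b _ _ ha hb; rw [sbr_add_right]; exact S.add_mem ha hb
      · intro c a _ ha; rw [sbr_smul_right]; exact S.smul_mem _ ha
    · rw [sbr_zero_left]; exact S.zero_mem
    · intro a b _ _ ha hb; rw [sbr_add_left]; exact S.add_mem ha hb
    · intro c a _ ha; rw [sbr_smul_left]; exact S.smul_mem _ ha
  have hdec : ∀ x ∈ S, ∃ x0 ∈ S, ∃ x1 ∈ S, x0 ∈ grd F T 0 ∧ x1 ∈ grd F T 1 ∧ x0 + x1 = x := by
    intro x hx
    refine Submodule.span_induction (p := fun x _ => ∃ x0 ∈ S, ∃ x1 ∈ S,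
      x0 ∈ grd F T 0 ∧ x1 ∈ grd F T 1 ∧ x0 + x1 = x) ?_ ?_ ?_ ?_ hx
    · rintro _ ⟨m, n, rfl⟩
      obtain ⟨m0, hm0, m1, hm1, rfl⟩ := exists_decomp F m
      obtain ⟨n0, hn0, n1, hn1, rfl⟩ := exists_decomp F n
      refine ⟨t m0 n0 + t m1 n1, S.add_mem (hmem _ _) (hmem _ _),
        t m0 n1 + t m1 n0, S.add_mem (hmem _ _) (hmem _ _),
        Submodule.add_mem _ (r.grade 0 0 _ hm0 _ hn0) (r.grade 1 1 _ hm1 _ hn1),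
        Submodule.add_mem _ (r.grade 0 1 _ hm0 _ hn1) (r.grade 1 0 _ hm1 _ hn0), ?_⟩
      simp only [r.add_left, r.add_right]
      abel
    · exact ⟨0, S.zero_mem, 0, S.zero_mem, Submodule.zero_mem _, Submodule.zero_mem _, add_zero _⟩
    · rintro _ _ _ _ ⟨a0, ha0, a1, ha1, h0, h1, rfl⟩ ⟨b0, hb0, b1, hb1, k0, k1, rfl⟩
      exact ⟨a0 + b0, S.add_mem ha0 hb0, a1 + b1, S.add_mem ha1 hb1, Submodule.add_mem _ h0 k0,
        Submodule.add_mem _ h1 k1, by abel⟩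
    · rintro c _ _ ⟨a0, ha0, a1, ha1, h0, h1, rfl⟩
      exact ⟨c • a0, S.smul_mem _ ha0, c • a1, S.smul_mem _ ha1, Submodule.smul_mem _ _ h0,
        Submodule.smul_mem _ _ h1, (smul_add _ _ _).symm⟩
  letI : LieSuper F S := pull F S.subtype S.injective_subtype
    (fun x y => ⟨sbr F x.1 y.1, hbr _ x.2 _ y.2⟩) (fun _ _ => rfl) (fun x => by
      obtain ⟨x0, h0, x1, h1, k0, k1, h⟩ := hdec x.1 x.2
      exact ⟨⟨x0, h0⟩, ⟨x1, h1⟩, k0, k1, Subtype.ext h⟩)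
  have hrel : TensorRel F actMN actNM (fun m n => (⟨t m n, hmem m n⟩ : S)) :=
    TensorRel.of_inj S.subtype S.injective_subtype (fun _ _ => rfl) (fun _ _ h => h) r
  obtain ⟨h, ⟨⟨h1, h2⟩, h3⟩, -⟩ := lift_small ht _ hrel
  obtain ⟨k, -, hk⟩ := lift_small ht t r
  have e1 := hk (S.subtype ∘ₗ h) ⟨⟨fun a x hx => h1 a x hx, fun x y =>
    congrArg S.subtype (h2 x y)⟩, fun m n => congrArg S.subtype (h3 m n)⟩
  have e2 := hk LinearMap.id ⟨⟨fun a x hx => hx, fun x y => rfl⟩, fun m n => rfl⟩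
  rw [eq_top_iff]
  intro x _
  have : S.subtype (h x) = x := by
    have := LinearMap.congr_fun (e1.trans e2.symm) x
    exact this
  rw [← this]
  exact (h x).2

theorem hom_ext {F : Type u} [Field F] {M N T : Type v} {Q : Type w}
    [AddCommGroup M] [Module F M] [LieSuper F M]
    [AddCommGroup N] [Module F N] [LieSuper F N]
    [AddCommGroup T] [Module F T] [LieSuper F T]
    [AddCommGroup Q] [Module F Q]
    {actMN : M → N → N} {actNM : N → M → M} {t : M → N → T}
    (ht : IsTensorObj F actMN actNM t) (f g : T →ₗ[F] Q)
    (h : ∀ m n, f (t m n) = g (t m n)) : f = g := by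
  refine LinearMap.ext_on (span_eq_top ht) ?_
  rintro _ ⟨m, n, rfl⟩
  exact h m n

section
variable {F : Type u} [Field F] {M N : Type v} {T : Type w}
    [AddCommGroup M] [Module F M] [LieSuper F M]
    [AddCommGroup N] [Module F N] [LieSuper F N]
    [AddCommGroup T] [Module F T] [LieSuper F T]

theorem TensorRel.zero_left {actMN : M → N → N} {actNM : N → M → M} {t : M → N → T}
    (r : TensorRel F actMN actNM t) (n : N) : t 0 n = 0 := by
  simpa using r.smul_left 0 0 n

theorem TensorRel.zero_right {actMN : M → N → N} {actNM : N → M → M} {t : M → N → T}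
    (r : TensorRel F actMN actNM t) (m : M) : t m 0 = 0 := by
  simpa using r.smul_right 0 m 0

theorem TensorRel.triv_left {t : M → N → T}
    (r : TensorRel F (fun _ _ => 0) (fun _ _ => 0) t) (x y : M) (n : N) :
    t (sbr F x y) n = 0 := by
  obtain ⟨x0, hx0, x1, hx1, rfl⟩ := exists_decomp F x
  obtain ⟨y0, hy0, y1, hy1, rfl⟩ := exists_decomp F y
  simp only [sbr_add_left, sbr_add_right, r.add_left]
  rw [r.brk_left _ _ _ hx0 _ hy0, r.brk_left _ _ _ hx0 _ hy1, r.brk_left _ _ _ hx1 _ hy0,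
    r.brk_left _ _ _ hx1 _ hy1]
  simp [r.zero_right]

theorem TensorRel.triv_right {t : M → N → T}
    (r : TensorRel F (fun _ _ => 0) (fun _ _ => 0) t) (m : M) (x y : N) :
    t m (sbr F x y) = 0 := by
  obtain ⟨m0, hm0, m1, hm1, rfl⟩ := exists_decomp F m
  obtain ⟨x0, hx0, x1, hx1, rfl⟩ := exists_decomp F x
  obtain ⟨y0, hy0, y1, hy1, rfl⟩ := exists_decomp F y
  simp only [sbr_add_left, sbr_add_right, r.add_right, r.add_left]
  rw [r.brk_right _ _ _ _ hm0 _ hx0 _ hy0, r.brk_right _ _ _ _ hm0 _ hx0 _ hy1,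
    r.brk_right _ _ _ _ hm0 _ hx1 _ hy0, r.brk_right _ _ _ _ hm0 _ hx1 _ hy1,
    r.brk_right _ _ _ _ hm1 _ hx0 _ hy0, r.brk_right _ _ _ _ hm1 _ hx0 _ hy1,
    r.brk_right _ _ _ _ hm1 _ hx1 _ hy0, r.brk_right _ _ _ _ hm1 _ hx1 _ hy1]
  simp [r.zero_left]

/-- Restriction of a pairing on `P` along even linear maps `i`, `j` into `P`. -/
theorem TensorRel.restrict {P : Type v} [AddCommGroup P] [Module F P] [LieSuper F P]
    {t : P → P → T} (r : TensorRel F (fun x y => sbr F x y) (fun x y => sbr F x y) t)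
    (i : M →ₗ[F] P) (j : N →ₗ[F] P) (hi : IsHom F i) (hj : IsHom F j)
    {actMN : M → N → N} {actNM : N → M → M}
    (h1 : ∀ m n, j (actMN m n) = sbr F (i m) (j n))
    (h2 : ∀ m n, i (actNM n m) = sbr F (j n) (i m)) :
    TensorRel F actMN actNM (fun m n => t (i m) (j n)) where
  add_left m m' n := by simp only [map_add, r.add_left]
  add_right m m' n := by simp only [map_add, r.add_right]
  smul_left m m' n := by simp only [map_smul, r.smul_left]
  smul_right m m' n := by simp only [map_smul, r.smul_right]
  grade a b m hm n hn := r.grade _ _ _ (hi.1 _ _ hm) _ (hj.1 _ _ hn)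
  brk_left a b m hm m' hm' n := by
    simp only [hi.2, h1]
    exact r.brk_left _ _ _ (hi.1 _ _ hm) _ (hi.1 _ _ hm') _
  brk_right a b c m hm m' hm' n hn := by
    simp only [hj.2, h2]
    exact r.brk_right _ _ _ _ (hi.1 _ _ hm) _ (hj.1 _ _ hm') _ (hj.1 _ _ hn)
  brk_brk a b m hm n hn m' n' := by
    simp only [h1, h2]
    exact r.brk_brk _ _ _ (hi.1 _ _ hm) _ (hj.1 _ _ hn) _ _

theorem isHom_inl : IsHom F (LinearMap.inl F M N) :=
  ⟨fun a x hx => (mem_grd_prod F a _).2 ⟨hx, Submodule.zero_mem _⟩, fun x y => by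
    simp [sbr_prod, sbr_zero_left]⟩

theorem isHom_inr : IsHom F (LinearMap.inr F M N) :=
  ⟨fun a x hx => (mem_grd_prod F a _).2 ⟨Submodule.zero_mem _, hx⟩, fun x y => by
    simp [sbr_prod, sbr_zero_left]⟩

end

/-- for Lie superalgebras `L` and `M` (acting on themselves and on
each other by Lie brackets, with `L` and `M` acting trivially on each other),
`(L ⊕ M) ⊗ (L ⊕ M) ≅ (L ⊗ L) ⊕ (L ⊗ M) ⊕ (M ⊗ L) ⊕ (M ⊗ M)`. -/
theorem tensor_square_prod (F : Type u) [Field F]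
    (hchar2 : (2 : F) ≠ 0) (hchar3 : (3 : F) ≠ 0)
    (L : Type v) [AddCommGroup L] [Module F L] [LieSuper F L]
    (M : Type v) [AddCommGroup M] [Module F M] [LieSuper F M]
    (T : Type v) [AddCommGroup T] [Module F T] [LieSuper F T]
    (T₁ : Type v) [AddCommGroup T₁] [Module F T₁] [LieSuper F T₁]
    (T₂ : Type v) [AddCommGroup T₂] [Module F T₂] [LieSuper F T₂]
    (T₃ : Type v) [AddCommGroup T₃] [Module F T₃] [LieSuper F T₃]
    (T₄ : Type v) [AddCommGroup T₄] [Module F T₄] [LieSuper F T₄]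
    (t : L × M → L × M → T) (t₁ : L → L → T₁) (t₂ : L → M → T₂)
    (t₃ : M → L → T₃) (t₄ : M → M → T₄)
    -- `(L ⊕ M) ⊗ (L ⊕ M)` with the self-actions by Lie brackets:
    (ht : IsTensorObj F (fun x y : L × M => sbr F x y) (fun x y : L × M => sbr F x y) t)
    -- `L ⊗ L` and `M ⊗ M` with the self-actions by Lie brackets:
    (ht₁ : IsTensorObj F (fun x y : L => sbr F x y) (fun x y : L => sbr F x y) t₁)
    (ht₄ : IsTensorObj F (fun x y : M => sbr F x y) (fun x y : M => sbr F x y) t₄)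
    -- `L ⊗ M` and `M ⊗ L` with the trivial mutual actions:
    (ht₂ : IsTensorObj F (fun (_ : L) (_ : M) => (0 : M)) (fun (_ : M) (_ : L) => (0 : L)) t₂)
    (ht₃ : IsTensorObj F (fun (_ : M) (_ : L) => (0 : L)) (fun (_ : L) (_ : M) => (0 : M)) t₃) :
    ∃ e : T ≃ₗ[F] T₁ × T₂ × T₃ × T₄, IsHom F e.toLinearMap := by
  have r := ht.rel
  have r₁ := ht₁.rel
  have r₂ := ht₂.rel
  have r₃ := ht₃.rel
  have r₄ := ht₄.rel
  obtain ⟨g₁, ⟨-, hg₁⟩, -⟩ := lift_small ht₁ _ (r.restrict (LinearMap.inl F L M)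
    (LinearMap.inl F L M) isHom_inl isHom_inl (fun m n => isHom_inl.2 m n)
    (fun m n => isHom_inl.2 n m))
  obtain ⟨g₂, ⟨-, hg₂⟩, -⟩ := lift_small ht₂ _ (r.restrict (LinearMap.inl F L M)
    (LinearMap.inr F L M) isHom_inl isHom_inr
    (fun m n => by simp [sbr_prod, sbr_zero_left, sbr_zero_right])
    (fun m n => by simp [sbr_prod, sbr_zero_left, sbr_zero_right]))
  obtain ⟨g₃, ⟨-, hg₃⟩, -⟩ := lift_small ht₃ _ (r.restrict (LinearMap.inr F L M)
    (LinearMap.inl F L M) isHom_inr isHom_inl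
    (fun m n => by simp [sbr_prod, sbr_zero_left, sbr_zero_right])
    (fun m n => by simp [sbr_prod, sbr_zero_left, sbr_zero_right]))
  obtain ⟨g₄, ⟨-, hg₄⟩, -⟩ := lift_small ht₄ _ (r.restrict (LinearMap.inr F L M)
    (LinearMap.inr F L M) isHom_inr isHom_inr (fun m n => isHom_inr.2 m n)
    (fun m n => isHom_inr.2 n m))
  have hq : TensorRel F (fun x y : L × M => sbr F x y) (fun x y : L × M => sbr F x y)
      (fun x y : L × M => (t₁ x.1 y.1, t₂ x.1 y.2, t₃ x.2 y.1, t₄ x.2 y.2)) := by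
    constructor
    · intro m m' n
      simp [r₁.add_left, r₂.add_left, r₃.add_left, r₄.add_left]
    · intro m m' n
      simp [r₁.add_right, r₂.add_right, r₃.add_right, r₄.add_right]
    · intro m m' n
      simp [r₁.smul_left, r₂.smul_left, r₃.smul_left, r₄.smul_left]
    · intro m m' n
      simp [r₁.smul_right, r₂.smul_right, r₃.smul_right, r₄.smul_right]
    · intro a b m hm n hn
      rw [mem_grd_prod] at hm hn
      simp only [mem_grd_prod]
      exact ⟨r₁.grade _ _ _ hm.1 _ hn.1, r₂.grade _ _ _ hm.1 _ hn.2,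
        r₃.grade _ _ _ hm.2 _ hn.1, r₄.grade _ _ _ hm.2 _ hn.2⟩
    · intro a b m hm m' hm' n
      rw [mem_grd_prod] at hm hm'
      simp only [sbr_prod, r₂.triv_left, r₂.triv_right, r₃.triv_left, r₃.triv_right,
        r₁.brk_left _ _ _ hm.1 _ hm'.1, r₄.brk_left _ _ _ hm.2 _ hm'.2]
      simp
    · intro a b c m hm n hn n' hn'
      rw [mem_grd_prod] at hm hn hn'
      simp only [sbr_prod, r₂.triv_left, r₂.triv_right, r₃.triv_left, r₃.triv_right,
        r₁.brk_right _ _ _ _ hm.1 _ hn.1 _ hn'.1, r₄.brk_right _ _ _ _ hm.2 _ hn.2 _ hn'.2]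
      simp
    · intro a b m hm n hn m' n'
      rw [mem_grd_prod] at hm hn
      simp only [sbr_prod, r₂.triv_left, r₃.triv_left,
        r₁.brk_brk _ _ _ hm.1 _ hn.1, r₄.brk_brk _ _ _ hm.2 _ hn.2,
        r₂.brk_brk _ _ _ hm.1 _ hn.2, r₃.brk_brk _ _ _ hm.2 _ hn.1, r₂.zero_left, r₃.zero_left]
      simp
  obtain ⟨f, ⟨hf, hft⟩, -⟩ := lift_small ht _ hq
  let g : T₁ × T₂ × T₃ × T₄ →ₗ[F] T := g₁.coprod (g₂.coprod (g₃.coprod g₄))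
  have hfg : f ∘ₗ g = LinearMap.id := by
    refine LinearMap.prod_ext (hom_ext ht₁ _ _ fun m n => ?_) (LinearMap.prod_ext
      (hom_ext ht₂ _ _ fun m n => ?_) (LinearMap.prod_ext
      (hom_ext ht₃ _ _ fun m n => ?_) (hom_ext ht₄ _ _ fun m n => ?_)))
    all_goals simp [g, hg₁, hg₂, hg₃, hg₄, hft, r₁.zero_left, r₁.zero_right, r₂.zero_left,
      r₂.zero_right, r₃.zero_left, r₃.zero_right, r₄.zero_left, r₄.zero_right]
  have hgf : g ∘ₗ f = LinearMap.id := by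
    refine hom_ext ht _ _ fun x y => ?_
    obtain ⟨l, m⟩ := x
    obtain ⟨l', m'⟩ := y
    have e1 : (l, m) = (l, 0) + (0, m) := by simp
    have e2 : (l', m') = (l', 0) + (0, m') := by simp
    simp only [LinearMap.comp_apply, hft, LinearMap.id_apply, g, LinearMap.coprod_apply,
      hg₁, hg₂, hg₃, hg₄, LinearMap.inl_apply, LinearMap.inr_apply]
    rw [e1, e2]
    simp only [r.add_left, r.add_right]
    abel
  exact ⟨LinearEquiv.ofLinear f g hfg hgf, hf⟩

end SuperLie
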